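/- Every simple object X of the Drinfeld center Center (FdRep ℂ (ZMod 2)) satisfies X ⊗ X ≅ 𝟙, where 𝟙 is the tensor unit of the center. (This encodes the fusion rules e ⊗ e = m ⊗ m = f ⊗ f = 𝟙 of the four topological sectors of ℤ₂-symmetric operators.) -/

import Mathlib

open CategoryTheory MonoidalCategory Limits

/-- The Drinfeld center of a monoidally preadditive category has zero morphisms. -/
noncomputable instance centerHasZeroMorphisms {C : Type*} [Category C] [Preadditive C]
    [MonoidalCategory C] [MonoidalPreadditive C] :
    HasZeroMorphisms (Center C) where
  zero X Y := ⟨{ f := (0 : X.1 ⟶ Y.1), comm := fun U => by simp }⟩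
  comp_zero f Z := by apply Center.ext; show f.f ≫ 0 = 0; simp
  zero_comp X {Y Z} g := by apply Center.ext; show 0 ≫ g.f = 0; simp


namespace Fus
noncomputable section
abbrev G := Multiplicative (ZMod 2)
abbrev C := FDRep ℂ G

def lin {U W : C} (f : U ⟶ W) : U.V.obj →ₗ[ℂ] W.V.obj := f.hom.hom.hom

theorem lin_ext {U W : C} {f g : U ⟶ W} (h : ∀ x, lin f x = lin g x) : f = g := by
  apply Action.hom_ext
  apply InducedCategory.hom_ext
  apply ModuleCat.hom_ext
  exact LinearMap.ext h

def act (U : C) (g : G) : U.V.obj →ₗ[ℂ] U.V.obj := FDRep.ρ U g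

theorem act_mul (U : C) (g h : G) (x : U.V.obj) : act U (g * h) x = act U g (act U h x) := by
  simp [act]
theorem act_one (U : C) (x : U.V.obj) : act U 1 x = x := by
  simp [act]

def mkHom {U W : C} (f : U.V.obj →ₗ[ℂ] W.V.obj) (hf : ∀ g x, f (act U g x) = act W g (f x)) :
    U ⟶ W where
  hom := InducedCategory.homMk (ModuleCat.ofHom f)
  comm g := by
    apply InducedCategory.hom_ext
    apply ModuleCat.hom_ext
    exact LinearMap.ext (hf g)

theorem lin_mkHom {U W : C} (f : U.V.obj →ₗ[ℂ] W.V.obj) (hf) : lin (mkHom (U := U) (W := W) f hf) = f := rfl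

theorem lin_act {U W : C} (f : U ⟶ W) (g : G) (x : U.V.obj) :
    lin f (act U g x) = act W g (lin f x) := by
  have := congrArg (fun t => t.hom.hom x) (f.comm g)
  exact this

theorem lin_comp {U W Z : C} (f : U ⟶ W) (g : W ⟶ Z) (x) : lin (f ≫ g) x = lin g (lin f x) := rfl
theorem lin_id {U : C} (x) : lin (𝟙 U) x = x := rfl

/-- pure tensors -/
def tm {U W : C} (x : U.V.obj) (y : W.V.obj) : (U ⊗ W : C).V.obj := TensorProduct.tmul ℂ (M := U.V.obj) (N := W.V.obj) x y

theorem act_tm {U W : C} (g : G) (x : U.V.obj) (y : W.V.obj) :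
    act (U ⊗ W) g (tm x y) = tm (act U g x) (act W g y) := rfl
theorem lin_wl (Z : C) {U W : C} (f : U ⟶ W) (x : U.V.obj) (z : Z.V.obj) :
    lin (Z ◁ f) (tm z x) = tm z (lin f x) := rfl
theorem lin_wr (Z : C) {U W : C} (f : U ⟶ W) (x : U.V.obj) (z : Z.V.obj) :
    lin (f ▷ Z) (tm x z) = tm (lin f x) z := rfl
theorem lin_assoc (U W Z : C) (x : U.V.obj) (y : W.V.obj) (z : Z.V.obj) :
    lin (α_ U W Z).hom (tm (tm x y) z) = tm x (tm y z) := rfl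
theorem lin_assoc_inv (U W Z : C) (x : U.V.obj) (y : W.V.obj) (z : Z.V.obj) :
    lin (α_ U W Z).inv (tm x (tm y z)) = tm (tm x y) z := rfl
theorem lin_lu (U : C) (c : ℂ) (x : U.V.obj) :
    lin (λ_ U).hom (tm (U := 𝟙_ C) (c : ℂ) x) = c • x := rfl
theorem lin_ru_inv (U : C) (x : U.V.obj) :
    lin (ρ_ U).inv x = tm (W := 𝟙_ C) x (1 : ℂ) := rfl
theorem lin_br (U W : C) (x : U.V.obj) (y : W.V.obj) :
    lin (β_ U W).hom (tm x y) = tm y x := rfl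

theorem lin_tm_ext {U W Z : C} {f g : (U ⊗ W : C) ⟶ Z} 
    (h : ∀ (x : U.V.obj) (y : W.V.obj), lin f (tm x y) = lin g (tm x y)) : f = g := by
  apply lin_ext
  have : lin f = lin g := TensorProduct.ext' h
  intro x; rw [this]

/-- The action of a group element, as an automorphism (the group is commutative). -/
def z (h : G) (U : C) : U ≅ U where
  hom := mkHom (act U h) (fun g x => by rw [← act_mul, ← act_mul, mul_comm])
  inv := mkHom (act U h⁻¹) (fun g x => by rw [← act_mul, ← act_mul, mul_comm])
  hom_inv_id := lin_ext fun x => by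
    rw [lin_comp, lin_mkHom, lin_mkHom, ← act_mul, inv_mul_cancel, act_one]; rfl
  inv_hom_id := lin_ext fun x => by
    rw [lin_comp, lin_mkHom, lin_mkHom, ← act_mul, mul_inv_cancel, act_one]; rfl

theorem lin_z (h : G) (U : C) (x : U.V.obj) : lin (z h U).hom x = act U h x := rfl

theorem lin_tm_ext3 {U W Z T : C} {f g : (U ⊗ (W ⊗ Z) : C) ⟶ T}
    (h : ∀ (x : U.V.obj) (y : W.V.obj) (t : Z.V.obj),
      lin f (tm x (tm y t)) = lin g (tm x (tm y t))) : f = g := by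
  apply lin_ext
  have : lin f = lin g := TensorProduct.ext_threefold' h
  intro x; rw [this]

theorem lin_tm_ext3' {U W Z T : C} {f g : ((U ⊗ W) ⊗ Z : C) ⟶ T}
    (h : ∀ (x : U.V.obj) (y : W.V.obj) (t : Z.V.obj),
      lin f (tm (tm x y) t) = lin g (tm (tm x y) t)) : f = g := by
  apply lin_ext
  have : lin f = lin g := TensorProduct.ext_threefold h
  intro x; rw [this]

/-- The twisted central object: `L` with half-braiding the swap twisted by `h`. -/
def T (L : C) (h : G) : Center C :=
  ⟨L, { β := fun U => whiskerLeftIso L (z h U) ≪≫ β_ L U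
        monoidal := fun U U' => lin_tm_ext3 fun x y t => by
          simp only [Iso.trans_hom, whiskerLeftIso_hom, lin_comp, lin_wl, lin_wr, lin_br,
            lin_assoc, lin_assoc_inv, lin_z, act_tm]
        naturality := fun {U U'} f => lin_tm_ext fun x y => by
          simp only [Iso.trans_hom, whiskerLeftIso_hom, lin_comp, lin_wl, lin_wr, lin_br,
            lin_z, lin_act] }⟩

theorem lin_T (L : C) (h : G) (U : C) (x : L.V.obj) (u : U.V.obj) :
    lin ((T L h).2.β U).hom (tm x u) = tm (act U h u) x := rfl

/-- one-dimensional representation -/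
def L (χ : G →* ℂ) : C := FDRep.of (V := ℂ)
  { toFun := fun g => χ g • LinearMap.id
    map_one' := by ext; simp
    map_mul' := fun a b => by ext; simp [mul_comm] }

theorem act_L (χ : G →* ℂ) (g : G) (x : ℂ) : act (L χ) g x = (χ g * x : ℂ) := rfl

theorem sq_one (g : G) : g * g = 1 := by revert g; decide

theorem chi_sq (χ : G →* ℂ) (g : G) : χ g * χ g = 1 := by rw [← map_mul, sq_one, map_one]

/-- multiplication -/
def mulHom (χ ψ : G →* ℂ) : (L χ ⊗ L ψ : C) ⟶ L (χ * ψ) :=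
  mkHom (U := L χ ⊗ L ψ) (W := L (χ * ψ)) (LinearMap.mul' ℂ ℂ) (fun g x => by
    have : (LinearMap.mul' ℂ ℂ) ∘ₗ (act (L χ ⊗ L ψ) g) =
        (act (L (χ * ψ)) g) ∘ₗ (LinearMap.mul' ℂ ℂ) := by
      refine TensorProduct.ext' fun (x y : ℂ) => ?_
      change (χ g * x) * (ψ g * y) = (χ g * ψ g) * (x * y)
      ring
    exact LinearMap.congr_fun this x)

theorem lin_mulHom (χ ψ : G →* ℂ) (x y : ℂ) :
    lin (mulHom χ ψ) (tm (U := L χ) (W := L ψ) x y) = (x * y : ℂ) := rfl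

/-- the fusion isomorphism on underlying objects -/
def sqIso (χ : G →* ℂ) : (L χ ⊗ L χ : C) ≅ 𝟙_ C where
  hom := mkHom (U := L χ ⊗ L χ) (W := 𝟙_ C) (LinearMap.mul' ℂ ℂ) (fun g x => by
    have : (LinearMap.mul' ℂ ℂ) ∘ₗ (act (L χ ⊗ L χ) g) = (LinearMap.mul' ℂ ℂ) := by
      refine TensorProduct.ext' fun (x y : ℂ) => ?_
      change (χ g * x) * (χ g * y) = (x * y)
      linear_combination (x * y) * chi_sq χ g
    exact LinearMap.congr_fun this x)
  inv := mkHom (U := 𝟙_ C) (W := L χ ⊗ L χ) (TensorProduct.mk ℂ ℂ ℂ 1) (fun g (x : ℂ) => by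
    change TensorProduct.tmul ℂ (1 : ℂ) (x : ℂ) =
      TensorProduct.tmul ℂ (χ g * 1 : ℂ) (χ g * x : ℂ)
    rw [← smul_eq_mul, ← smul_eq_mul, TensorProduct.smul_tmul, smul_smul, chi_sq, one_smul])
  hom_inv_id := lin_tm_ext fun (x y : ℂ) => by
    change TensorProduct.tmul ℂ (1 : ℂ) ((x : ℂ) * (y : ℂ)) = TensorProduct.tmul ℂ (x : ℂ) (y : ℂ)
    rw [← smul_eq_mul, ← TensorProduct.smul_tmul, smul_eq_mul, mul_one]
  inv_hom_id := lin_ext fun (x : ℂ) => by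
    change (1 : ℂ) * (x : ℂ) = (x : ℂ)
    rw [one_mul]

theorem tm_smul {U W : C} (c : ℂ) (x : U.V.obj) (y : W.V.obj) : tm x (c • y) = tm (c • x) y :=
  (TensorProduct.smul_tmul (R := ℂ) c x y).symm

theorem lin_sqIso (χ : G →* ℂ) (x y : ℂ) :
    lin (sqIso χ).hom (tm (U := L χ) (W := L χ) x y) = (x * y : ℂ) := rfl

def sqHom (χ : G →* ℂ) (h : G) : T (L χ) h ⊗ T (L χ) h ⟶ 𝟙_ (Center C) where
  f := (sqIso χ).hom
  comm U := lin_tm_ext3' (U := L χ) (W := L χ) (Z := U) fun (x y : ℂ) u => by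
    rw [Center.tensor_β, Center.tensorUnit_β]
    simp only [Iso.trans_hom, whiskerLeftIso_hom, whiskerRightIso_hom, Iso.symm_hom]
    have e1 : lin ((sqIso χ).hom ▷ U ≫ (λ_ U).hom ≫ (ρ_ U).inv) (tm (tm (U := L χ) (W := L χ) x y) u) =
        tm (W := 𝟙_ C) (((x : ℂ) * (y : ℂ) : ℂ) • u) (1 : ℂ) := rfl
    refine e1.trans ?_
    have e2 : lin ((α_ _ _ _).hom ≫ (L χ) ◁ ((T (L χ) h).2.β U).hom ≫ (α_ _ _ _).inv ≫
      ((T (L χ) h).2.β U).hom ▷ (L χ) ≫ (α_ _ _ _).hom ≫ U ◁ (sqIso χ).hom) (tm (tm (U := L χ) (W := L χ) x y) u) =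
        tm (W := 𝟙_ C) (act U h (act U h u)) ((x : ℂ) * (y : ℂ) : ℂ) := rfl
    refine Eq.trans ?_ e2.symm
    rw [← act_mul, sq_one, act_one, ← tm_smul]
    congr 1
    exact mul_one (x * y)

theorem sq_iso (χ : G →* ℂ) (h : G) : Nonempty (T (L χ) h ⊗ T (L χ) h ≅ 𝟙_ (Center C)) := by
  have : IsIso (sqHom χ h).f := inferInstanceAs (IsIso (sqIso χ).hom)
  exact ⟨Center.isoMk (sqHom χ h)⟩

/-- basis vector -/
def one (χ : G →* ℂ) : (L χ).V.obj := (1 : ℂ)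

theorem act_one_vec (χ : G →* ℂ) (g : G) : act (L χ) g (one χ) = χ g • one χ := rfl

theorem mulHom_one (χ ψ : G →* ℂ) : lin (mulHom χ ψ) (tm (one χ) (one ψ)) = one (χ * ψ) :=
  (one_mul (1 : ℂ))

theorem tm_smul_left {U W : C} (c : ℂ) (x : U.V.obj) (y : W.V.obj) :
    tm (c • x) y = c • tm x y := rfl

theorem tm_smul_right {U W : C} (c : ℂ) (x : U.V.obj) (y : W.V.obj) :
    tm x (c • y) = c • tm x y := by rw [tm_smul, tm_smul_left]

theorem tm_add_left {U W : C} (x x' : U.V.obj) (y : W.V.obj) :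
    tm (x + x') y = tm x y + tm x' y := TensorProduct.add_tmul _ _ _

theorem tm_add_right {U W : C} (x : U.V.obj) (y y' : W.V.obj) :
    tm x (y + y') = tm x y + tm x y' := TensorProduct.tmul_add _ _ _

/-- `ℂ ⊗ V ≃ V` -/
def lidL (χ : G →* ℂ) (V : C) : (L χ ⊗ V : C).V.obj ≃ₗ[ℂ] V.V.obj := TensorProduct.lid ℂ V.V.obj

/-- `V ⊗ ℂ ≃ V` -/
def ridL (χ : G →* ℂ) (V : C) : (V ⊗ L χ : C).V.obj ≃ₗ[ℂ] V.V.obj := TensorProduct.rid ℂ V.V.obj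

theorem lidL_tm (χ : G →* ℂ) (V : C) (v : V.V.obj) : lidL χ V (tm (one χ) v) = v :=
  one_smul ℂ v

theorem ridL_tm (χ : G →* ℂ) (V : C) (v : V.V.obj) : ridL χ V (tm v (one χ)) = v :=
  one_smul ℂ v

section
variable (X : Center C)

/-- half-braiding with a character, as an endomorphism of the vector space -/
def B (χ : G →* ℂ) (v : X.1.V.obj) : X.1.V.obj :=
  lidL χ X.1 (lin (X.2.β (L χ)).hom (tm v (one χ)))

theorem beta_one (χ : G →* ℂ) (v : X.1.V.obj) :
    lin (X.2.β (L χ)).hom (tm v (one χ)) = tm (one χ) (B X χ v) := by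
  apply (lidL χ X.1).injective
  rw [lidL_tm]; rfl

theorem B_add (χ : G →* ℂ) (v w : X.1.V.obj) : B X χ (v + w) = B X χ v + B X χ w := by
  simp only [B, tm_add_left, map_add]

theorem B_inj (χ : G →* ℂ) {v w : X.1.V.obj} (h : B X χ v = B X χ w) : v = w := by
  have h1 : lin (X.2.β (L χ)).hom (tm v (one χ)) = lin (X.2.β (L χ)).hom (tm w (one χ)) := by
    rw [beta_one, beta_one, h]
  have h2 := congrArg (lin (X.2.β (L χ)).inv) h1
  rw [← lin_comp, ← lin_comp, Iso.hom_inv_id, lin_id, lin_id] at h2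
  rw [← ridL_tm χ X.1 v, ← ridL_tm χ X.1 w, h2]

theorem B_mul (χ ψ : G →* ℂ) (v : X.1.V.obj) : B X (χ * ψ) v = B X ψ (B X χ v) := by
  have h := congrArg (fun f => lin f (tm v (tm (one χ) (one ψ))))
    (X.2.naturality (mulHom χ ψ))
  simp only [HalfBraiding.monoidal, lin_comp, lin_wl, lin_wr, lin_assoc, lin_assoc_inv,
    beta_one, mulHom_one] at h
  rw [← lidL_tm (χ * ψ) X.1 (B X (χ * ψ) v), h, lidL_tm]

theorem B_one (v : X.1.V.obj) : B X 1 v = v := by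
  apply B_inj X 1
  rw [← B_mul, one_mul]

theorem chi_ne (χ : G →* ℂ) (g : G) : χ g ≠ 0 := by
  intro h; have := chi_sq χ g; rw [h] at this; simp at this

theorem B_act (χ : G →* ℂ) (g : G) (v : X.1.V.obj) :
    B X χ (act X.1 g v) = act X.1 g (B X χ v) := by
  have h := lin_act (X.2.β (L χ)).hom g (tm v (one χ))
  rw [beta_one, act_tm, act_tm, act_one_vec, tm_smul_left, tm_smul_right, map_smul,
    beta_one] at h
  have h2 := smul_right_injective _ (chi_ne χ g) h
  rw [← lidL_tm χ X.1 (act X.1 g (B X χ v)), ← h2, lidL_tm]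

/-- vector as a morphism -/
def vec (χ : G →* ℂ) (U : C) (u : U.V.obj) (hu : ∀ g, act U g u = χ g • u) : L χ ⟶ U :=
  mkHom (U := L χ) (W := U) (LinearMap.toSpanSingleton ℂ U.V.obj u) (fun g (x : ℂ) => by
    change (χ g * x) • u = act U g (x • u)
    rw [map_smul, hu, smul_smul, mul_comm])

theorem vec_one (χ : G →* ℂ) (U : C) (u : U.V.obj) (hu) : lin (vec χ U u hu) (one χ) = u :=
  one_smul ℂ u

theorem beta_vec (χ : G →* ℂ) (U : C) (u : U.V.obj) (hu : ∀ g, act U g u = χ g • u)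
    (v : X.1.V.obj) : lin (X.2.β U).hom (tm v u) = tm u (B X χ v) := by
  have h := congrArg (fun f => lin f (tm v (one χ))) (X.2.naturality (vec χ U u hu))
  simpa only [lin_comp, lin_wl, lin_wr, beta_one, vec_one] using h

/-- generator -/
def gg : G := Multiplicative.ofAdd 1

theorem G_cases (g : G) : g = 1 ∨ g = gg := by revert g; decide

/-- sign character -/
def sgn : G →* ℂ where
  toFun g := if g = 1 then 1 else -1
  map_one' := by simp
  map_mul' a b := by
    have h : gg ≠ 1 := by decide
    rcases G_cases a with rfl | rfl <;> rcases G_cases b with rfl | rfl <;> simp [sq_one, h]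

theorem sgn_gg : sgn gg = -1 := by
  have h : gg ≠ 1 := by decide
  simp [sgn, h]

theorem hu_of (χ : G →* ℂ) (U : C) (u : U.V.obj) (h : act U gg u = χ gg • u) (g : G) :
    act U g u = χ g • u := by
  rcases G_cases g with rfl | rfl
  · rw [act_one, map_one, one_smul]
  · exact h

theorem act_gg_sq (U : C) (u : U.V.obj) : act U gg (act U gg u) = u := by
  rw [← act_mul, sq_one, act_one]

theorem beta_plus (U : C) (u : U.V.obj) (v : X.1.V.obj) :
    lin (X.2.β U).hom (tm v (u + act U gg u)) = tm (u + act U gg u) v := by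
  rw [beta_vec X 1 U _ (hu_of 1 U _ _), B_one]
  rw [map_add, act_gg_sq, MonoidHom.one_apply, one_smul, add_comm]

theorem beta_minus (U : C) (u : U.V.obj) (v : X.1.V.obj) :
    lin (X.2.β U).hom (tm v (u + (-1 : ℂ) • act U gg u)) =
      tm (u + (-1 : ℂ) • act U gg u) (B X sgn v) := by
  rw [beta_vec X sgn U _ (hu_of sgn U _ _)]
  rw [map_add, map_smul, act_gg_sq, sgn_gg, smul_add, smul_smul]
  norm_num [add_comm]

theorem sgn_sq : sgn * sgn = 1 := by
  ext g; simp [chi_sq]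

theorem B_sgn_sq (v : X.1.V.obj) : B X sgn (B X sgn v) = v := by
  rw [← B_mul, sgn_sq, B_one]

theorem beta_eig (h : G) (v : X.1.V.obj) (hv : B X sgn v = sgn h • v) (U : C) (u : U.V.obj) :
    lin (X.2.β U).hom (tm v u) = tm (act U h u) v := by
  have key : u = (1 / 2 : ℂ) • ((u + act U gg u) + (u + (-1 : ℂ) • act U gg u)) := by module
  have e : lin (X.2.β U).hom (tm v u) =
      tm ((1 / 2 : ℂ) • ((u + act U gg u) + sgn h • (u + (-1 : ℂ) • act U gg u))) v := by
    conv_lhs => rw [key]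
    rw [tm_smul_right, map_smul, tm_add_right, map_add, beta_plus, beta_minus, hv, tm_smul_right,
      ← tm_smul_left (sgn h), ← tm_add_left, ← tm_smul_left]
  rw [e]
  congr 1
  rcases G_cases h with rfl | rfl
  · rw [map_one, act_one]; module
  · rw [sgn_gg]; module

/-- A joint eigenvector gives a morphism. -/
def eigHom (χ : G →* ℂ) (h : G) (v : X.1.V.obj) (hχ : ∀ g, act X.1 g v = χ g • v)
    (hv : B X sgn v = sgn h • v) : T (L χ) h ⟶ X where
  f := vec χ X.1 v hχ
  comm U := lin_tm_ext (U := L χ) (W := U) fun (x : ℂ) u => by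
    change lin (X.2.β U).hom (tm (x • v) u) = tm (act U h u) (x • v)
    rw [tm_smul_left, map_smul, beta_eig X h v hv, tm_smul_right]

theorem exists_eig (v₀ : X.1.V.obj) (h₀ : v₀ ≠ 0) :
    ∃ (χ : G →* ℂ) (h : G) (v : X.1.V.obj), v ≠ 0 ∧ (∀ g, act X.1 g v = χ g • v) ∧
      B X sgn v = sgn h • v := by
  obtain ⟨χ, w, hw, hχ⟩ : ∃ (χ : G →* ℂ) (w : X.1.V.obj), w ≠ 0 ∧
      (∀ g, act X.1 g w = χ g • w) := by
    by_cases hz : v₀ + act X.1 gg v₀ = 0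
    · refine ⟨sgn, v₀, h₀, hu_of _ _ _ ?_⟩
      rw [sgn_gg, neg_one_smul]
      exact (neg_eq_of_add_eq_zero_right hz).symm
    · refine ⟨1, _, hz, hu_of _ _ _ ?_⟩
      rw [map_add, act_gg_sq, MonoidHom.one_apply, one_smul, add_comm]
  by_cases hz : w + B X sgn w = 0
  · refine ⟨χ, gg, w, hw, hχ, ?_⟩
    rw [sgn_gg, neg_one_smul]
    exact (neg_eq_of_add_eq_zero_right hz).symm
  · refine ⟨χ, 1, _, hz, fun g => ?_, ?_⟩
    · have hB : B X sgn (χ g • w) = χ g • B X sgn w := by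
        simp only [B, tm_smul_left, map_smul]
      rw [map_add, ← B_act, hχ, hB, smul_add]
    · rw [B_add, B_sgn_sq, map_one, one_smul, add_comm]

theorem main (hX : Simple X) : Nonempty (X ⊗ X ≅ 𝟙_ (Center C)) := by
  obtain ⟨v₀, h₀⟩ : ∃ v₀ : X.1.V.obj, v₀ ≠ 0 := by
    by_contra! hc
    apply id_nonzero X
    apply Center.ext
    exact lin_ext fun x => (hc _).trans (hc _).symm
  obtain ⟨χ, h, v, hv, hχ, hB⟩ := exists_eig X v₀ h₀
  let f := eigHom X χ h v hχ hB
  have hm : Mono f := ⟨fun {Z} a b hab => by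
    apply Center.ext
    refine lin_ext fun x => ?_
    have h1 : lin (a ≫ f).f x = lin (b ≫ f).f x := by rw [hab]
    exact smul_left_injective ℂ hv h1⟩
  have hf : f ≠ 0 := by
    intro h0
    have h1 : lin f.f (one χ) = 0 := by rw [h0]; rfl
    exact hv ((vec_one χ X.1 v hχ).symm.trans h1)
  have : IsIso f := (Simple.mono_isIso_iff_nonzero f).2 hf
  obtain ⟨i⟩ := sq_iso χ h
  exact ⟨((asIso f).symm ⊗ᵢ (asIso f).symm) ≪≫ i⟩

end
end
end Fus

/-- Every simple object `X` of the Drinfeld center of `FDRep ℂ (ℤ/2)` satisfies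
`X ⊗ X ≅ 𝟙`: the fusion rules `e ⊗ e = m ⊗ m = f ⊗ f = 𝟙` of the four topological
sectors of `ℤ₂`-symmetric operators. -/
theorem center_fdRep_zmod_two_fusion_square (X : Center (FDRep ℂ (Multiplicative (ZMod 2))))
    (hX : Simple X) :
    Nonempty (X ⊗ X ≅ 𝟙_ (Center (FDRep ℂ (Multiplicative (ZMod 2))))) := by
  exact Fus.main X hX
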